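/- Let ∙ be an orthogonal Clifford module structure on v over z, and let X = (X_z, X_v) ∈ z × v with X_z ≠ 0 and X_v ≠ 0. Then for Z ∈ z the following are equivalent: (i) K̂(X)² Z = −‖X_z‖² · ‖X_v‖⁴ · Z; (ii) there exists Z̃ ∈ z with Z ∙ (X_z ∙ X_v) = Z̃ ∙ X_v. Moreover, if (ii) holds then ‖X_v‖² · Z̃ = K̂(X) Z. -/

import Mathlib

open scoped RealInnerProductSpace

section CliffordModule

variable {z v : Type*} [NormedAddCommGroup z] [InnerProductSpace ℝ z]
  [NormedAddCommGroup v] [InnerProductSpace ℝ v] {c : z →ₗ[ℝ] v →ₗ[ℝ] v}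

lemma clifford_anticomm
    (hc2 : ∀ (Z : z) (S : v), c Z (c Z S) = (-‖Z‖ ^ 2 : ℝ) • S) (A B : z) (S : v) :
    c A (c B S) = -c B (c A S) - (2 * ⟪A, B⟫) • S := by
  have h := hc2 (A + B) S
  rw [norm_add_sq_real] at h
  simp only [map_add, LinearMap.add_apply, hc2] at h
  rw [← sub_eq_zero] at h ⊢
  rw [← h]
  module

lemma clifford_norm_apply
    (hc1 : ∀ (Z : z) (S S' : v), ⟪c Z S, S'⟫ = -⟪S, c Z S'⟫)
    (hc2 : ∀ (Z : z) (S : v), c Z (c Z S) = (-‖Z‖ ^ 2 : ℝ) • S) (Z : z) (S : v) :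
    ‖c Z S‖ = ‖Z‖ * ‖S‖ := by
  refine (sq_eq_sq₀ (norm_nonneg _) (by positivity)).1 ?_
  rw [← real_inner_self_eq_norm_sq, hc1, hc2, inner_smul_right, real_inner_self_eq_norm_sq]
  ring

lemma clifford_inner_apply_apply
    (hc1 : ∀ (Z : z) (S S' : v), ⟪c Z S, S'⟫ = -⟪S, c Z S'⟫)
    (hc2 : ∀ (Z : z) (S : v), c Z (c Z S) = (-‖Z‖ ^ 2 : ℝ) • S) (A B : z) (S : v) :
    ⟪c A S, c B S⟫ = ‖S‖ ^ 2 * ⟪A, B⟫ := by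
  have h := norm_add_sq_real (c A S) (c B S)
  rw [← LinearMap.add_apply, ← map_add] at h
  simp only [clifford_norm_apply hc1 hc2, mul_pow, norm_add_sq_real] at h
  linarith

lemma clifford_inner_skew
    (hc1 : ∀ (Z : z) (S S' : v), ⟪c Z S, S'⟫ = -⟪S, c Z S'⟫)
    (hc2 : ∀ (Z : z) (S : v), c Z (c Z S) = (-‖Z‖ ^ 2 : ℝ) • S) (A Z W : z) (S : v) :
    ⟪c Z (c A S), c W S⟫ = -⟪c W (c A S), c Z S⟫ := by
  have orth (Y : z) : ⟪S, c Y S⟫ = 0 := by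
    have h := hc1 Y S S
    rw [real_inner_comm] at h
    linarith
  have move (Y Y' : z) : ⟪c Y (c A S), c Y' S⟫ = -⟪c A (c Y S), c Y' S⟫ := by
    rw [clifford_anticomm hc2 Y A, inner_sub_left, inner_neg_left, real_inner_smul_left, orth]
    ring
  rw [move, hc1, neg_neg, real_inner_comm, move W Z, neg_neg]

end CliffordModule

/-- Characterization of the top eigenvalue: `K̂(X)² Z = −‖X_z‖²‖X_v‖⁴ Z` iff
`Z ∙ (X_z ∙ X_v) = Z̃ ∙ X_v` for some `Z̃`; and in that case `‖X_v‖² Z̃ = K̂(X) Z`. -/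
theorem stmt_4 {z v : Type*}
    [NormedAddCommGroup z] [InnerProductSpace ℝ z] [FiniteDimensional ℝ z]
    [NormedAddCommGroup v] [InnerProductSpace ℝ v] [FiniteDimensional ℝ v]
    [Nontrivial v]
    (c : z →ₗ[ℝ] v →ₗ[ℝ] v)
    (hc1 : ∀ (Z : z) (S S' : v), ⟪c Z S, S'⟫ = -⟪S, c Z S'⟫)
    (hc2 : ∀ (Z : z) (S : v), c Z (c Z S) = (-‖Z‖ ^ 2 : ℝ) • S)
    (K : z × v → z →ₗ[ℝ] z)
    (hK : ∀ (X : z × v) (Z₁ Z₂ : z), ⟪K X Z₁, Z₂⟫ = ⟪c Z₁ (c X.1 X.2), c Z₂ X.2⟫)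
    (X : z × v) (hXz : X.1 ≠ 0) (hXv : X.2 ≠ 0) (Z : z) :
    (K X (K X Z) = (-(‖X.1‖ ^ 2 * ‖X.2‖ ^ 4) : ℝ) • Z ↔
      ∃ Zt : z, c Z (c X.1 X.2) = c Zt X.2) ∧
    (∀ Zt : z, c Z (c X.1 X.2) = c Zt X.2 → (‖X.2‖ ^ 2 : ℝ) • Zt = K X Z) := by
  obtain ⟨a, s⟩ := X
  dsimp only at hXz hXv ⊢
  replace hK (Y W : z) : ⟪K (a, s) Y, W⟫ = ⟪c Y (c a s), c W s⟫ := hK (a, s) Y W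
  generalize K (a, s) = T at hK ⊢
  have hs : ‖s‖ ≠ 0 := norm_ne_zero_iff.2 hXv
  have norm_apply := clifford_norm_apply hc1 hc2
  have skew (Y W : z) : ⟪T Y, W⟫ = -⟪T W, Y⟫ := by
    rw [hK, hK, clifford_inner_skew hc1 hc2]
  have norm_le (Y : z) : ‖T Y‖ ≤ ‖a‖ * ‖s‖ ^ 2 * ‖Y‖ := by
    have h := real_inner_le_norm (c Y (c a s)) (c (T Y) s)
    rw [← hK, real_inner_self_eq_norm_sq] at h
    simp only [norm_apply] at h
    rcases (norm_nonneg (T Y)).eq_or_lt with h0 | h0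
    · rw [← h0]; positivity
    · refine le_of_mul_le_mul_right ?_ h0
      linarith
  have sq_inner : ⟪T (T Z), Z⟫ = -‖T Z‖ ^ 2 := by
    rw [skew, real_inner_self_eq_norm_sq]
  have smul_eq (Zt : z) (h : c Z (c a s) = c Zt s) : (‖s‖ ^ 2 : ℝ) • Zt = T Z := by
    refine ext_inner_right ℝ fun W => ?_
    rw [hK, h, clifford_inner_apply_apply hc1 hc2, real_inner_smul_left]
  refine ⟨⟨fun h => ?_, ?_⟩, smul_eq⟩
  · have hnorm : ‖T Z‖ ^ 2 = ‖a‖ ^ 2 * ‖s‖ ^ 4 * ‖Z‖ ^ 2 := by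
      rw [h, real_inner_smul_left, real_inner_self_eq_norm_sq] at sq_inner
      linarith
    refine ⟨(‖s‖ ^ 2 : ℝ)⁻¹ • T Z, sub_eq_zero.1 <| norm_eq_zero.1 <| sq_eq_zero_iff.1 ?_⟩
    rw [norm_sub_sq_real, ← hK, real_inner_smul_right, real_inner_self_eq_norm_sq]
    simp only [norm_apply, norm_smul, norm_inv, norm_pow, norm_norm, mul_pow, hnorm]
    field_simp
    ring
  · rintro ⟨Zt, h⟩
    have hZt : ‖Z‖ * ‖a‖ = ‖Zt‖ := by
      have h' := congrArg norm h
      simp only [norm_apply, ← mul_assoc] at h'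
      exact mul_right_cancel₀ hs h'
    have hnorm : ‖T Z‖ = ‖a‖ * ‖s‖ ^ 2 * ‖Z‖ := by
      rw [← smul_eq Zt h, norm_smul, ← hZt, norm_pow, norm_norm]
      ring
    have hle : ‖T (T Z)‖ ^ 2 ≤ (‖a‖ * ‖s‖ ^ 2 * (‖a‖ * ‖s‖ ^ 2 * ‖Z‖)) ^ 2 := by
      rw [← hnorm]
      exact pow_le_pow_left₀ (norm_nonneg _) (norm_le _) 2
    refine sub_eq_zero.1 <| norm_eq_zero.1 <| sq_eq_zero_iff.1 <| le_antisymm ?_ (sq_nonneg _)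
    rw [norm_sub_sq_real, real_inner_smul_right, sq_inner, norm_smul, hnorm, norm_neg,
      Real.norm_of_nonneg (by positivity)]
    linarith
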